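/- Let T ∈ (0,∞], σ ∈ (0,T), A > 0 and B > 0, and suppose that y : [0,T) → [0,∞) is absolutely continuous and satisfies y'(t) + A·y(t) ≤ h(t) for almost every t ∈ (0,T), where h is a nonnegative locally integrable function on [0,T) such that ∫_t^{t+σ} h(s) ds ≤ B for all t ∈ (0, T−σ). Then y(t) ≤ max{ y(0) + B , B/(A·σ) + 2B } for all t ∈ (0,T). -/

import Mathlib

open MeasureTheory Set

/-- Comparison lemma for ODE inequalities (Lemma 2.3 of the paper):
if `y : [0,T) → [0,∞)` is absolutely continuous (encoded via the fundamental
theorem of calculus with an a.e. derivative `y'`), satisfies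
`y'(t) + A y(t) ≤ h(t)` a.e. on `(0,T)`, and the nonnegative locally integrable
forcing `h` satisfies `∫_t^{t+σ} h ≤ B` for all `t ∈ (0, T-σ)`, then
`y(t) ≤ max { y(0)+B , B/(Aσ) + 2B }` on `(0,T)`. Here `T ∈ (0,∞]` is encoded
as an extended real number. -/
theorem stmt_0
    (T : EReal) (hT : 0 < T)
    (σ A B : ℝ) (hσ : 0 < σ) (hσT : (σ : EReal) < T)
    (hA : 0 < A) (hB : 0 < B)
    (y y' h : ℝ → ℝ)
    (hy_nonneg : ∀ t : ℝ, 0 ≤ t → (t : EReal) < T → 0 ≤ y t)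
    (hy'_int : ∀ t : ℝ, 0 ≤ t → (t : EReal) < T → IntervalIntegrable y' volume 0 t)
    (hy_ac : ∀ t : ℝ, 0 ≤ t → (t : EReal) < T → y t = y 0 + ∫ s in (0:ℝ)..t, y' s)
    (hh_nonneg : ∀ t : ℝ, 0 ≤ t → (t : EReal) < T → 0 ≤ h t)
    (hh_int : ∀ t : ℝ, 0 ≤ t → (t : EReal) < T → IntervalIntegrable h volume 0 t)
    (hdiff : ∀ᵐ t : ℝ, 0 < t → (t : EReal) < T → y' t + A * y t ≤ h t)
    (hwin : ∀ t : ℝ, 0 < t → (t : EReal) + (σ : EReal) < T → ∫ s in t..(t + σ), h s ≤ B) :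
    ∀ t : ℝ, 0 < t → (t : EReal) < T →
      y t ≤ max (y 0 + B) (B / (A * σ) + 2 * B) := by
  have key : ∀ c s t : ℝ, 0 ≤ s → s ≤ t → (t : EReal) < T → (∀ r ∈ Ioc s t, c ≤ y r) →
      y t ≤ y s + (∫ r in s..t, h r) - A * c * (t - s) := by
    intro c s t hs hst ht hc
    have hlt : ∀ r : ℝ, r ≤ t → (r : EReal) < T := fun r hr =>
      lt_of_le_of_lt (EReal.coe_le_coe_iff.2 hr) ht
    have h0s := hy'_int s hs (hlt s hst)
    have h0t := hy'_int t (hs.trans hst) ht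
    have hst' := h0s.symm.trans h0t
    have hhst := (hh_int s hs (hlt s hst)).symm.trans (hh_int t (hs.trans hst) ht)
    have e1 := hy_ac s hs (hlt s hst)
    have e2 := hy_ac t (hs.trans hst) ht
    have e3 := intervalIntegral.integral_add_adjacent_intervals h0s hst'
    have e4 : ∫ r in s..t, y' r ≤ ∫ r in s..t, (h r - A * c) := by
      rw [intervalIntegral.integral_of_le hst, intervalIntegral.integral_of_le hst]
      refine setIntegral_mono_on_ae hst'.1 (hhst.sub intervalIntegrable_const).1
        measurableSet_Ioc ?_
      filter_upwards [hdiff] with r hr hm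
      have h1 := hr (lt_of_le_of_lt hs hm.1) (hlt r hm.2)
      have h2 := mul_le_mul_of_nonneg_left (hc r hm) hA.le
      linarith
    rw [intervalIntegral.integral_sub hhst intervalIntegrable_const,
      intervalIntegral.integral_const, smul_eq_mul] at e4
    linarith
  have mono : ∀ s a t : ℝ, 0 ≤ s → s ≤ a → a ≤ t → (t : EReal) < T →
      ∀ b, a ≤ b → b ≤ t → ∫ r in a..b, h r ≤ ∫ r in s..t, h r := by
    intro s a t hs hsa hat ht b hab hbt
    have hlt : ∀ r : ℝ, r ≤ t → (r : EReal) < T := fun r hr =>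
      lt_of_le_of_lt (EReal.coe_le_coe_iff.2 hr) ht
    have hst := hsa.trans hat
    have hhst := (hh_int s hs (hlt s hst)).symm.trans (hh_int t (hs.trans hst) ht)
    refine intervalIntegral.integral_mono_interval hsa hab hbt ?_ hhst
    filter_upwards [ae_restrict_mem measurableSet_Ioc] with r hr
    exact hh_nonneg r (hs.trans hr.1.le) (hlt r hr.2)
  have base : ∀ t : ℝ, 0 < t → t ≤ σ → y t ≤ y 0 + B := by
    intro t ht htσ
    obtain ⟨x, hx1, hx2⟩ := EReal.lt_iff_exists_real_btwn.1 hσT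
    have hx1 : σ < x := EReal.coe_lt_coe_iff.1 hx1
    have htT : (t : EReal) < T := lt_of_le_of_lt (EReal.coe_le_coe_iff.2 htσ) hσT
    have hcont : ContinuousWithinAt (fun s => y 0 + ∫ r in (0:ℝ)..s, y' r) (Icc 0 t) 0 := by
      have := intervalIntegral.continuousOn_primitive_interval
        (μ := volume) (f := y') (a := 0) (b := t)
        ((intervalIntegrable_iff' (by simp)).1 (hy'_int t ht.le htT))
      rw [uIcc_of_le ht.le] at this
      exact (continuousOn_const.add this) 0 ⟨le_rfl, ht.le⟩
    have hlim : Filter.Tendsto (fun s => (y 0 + ∫ r in (0:ℝ)..s, y' r) + B)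
        (nhdsWithin 0 (Ioo 0 t)) (nhds (y 0 + B)) := by
      have := (hcont.mono Ioo_subset_Icc_self).tendsto.add_const B
      simpa using this
    rw [nhdsWithin_Ioo_eq_nhdsGT ht] at hlim
    refine ge_of_tendsto hlim ?_
    have hm : (0:ℝ) < min t (x - σ) := lt_min ht (by linarith)
    filter_upwards [Ioo_mem_nhdsGT hm] with s hs
    have hst : s < t := lt_of_lt_of_le hs.2 (min_le_left _ _)
    have hsx : s < x - σ := lt_of_lt_of_le hs.2 (min_le_right _ _)
    have hsT : ((s + σ : ℝ) : EReal) < T :=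
      lt_of_le_of_lt (EReal.coe_le_coe_iff.2 (by linarith)) hx2
    rw [← hy_ac s hs.1.le (lt_of_le_of_lt (EReal.coe_le_coe_iff.2 hst.le) htT)]
    have h1 := key 0 s t hs.1.le hst.le htT (fun r hr => hy_nonneg r (hs.1.trans hr.1).le
      (lt_of_le_of_lt (EReal.coe_le_coe_iff.2 hr.2) htT))
    have h2 := mono s s (s + σ) hs.1.le le_rfl (by linarith) hsT t hst.le (by linarith [hs.1])
    have h3 := hwin s hs.1 (by rw [← EReal.coe_add]; exact hsT)
    linarith
  have ind : ∀ n : ℕ, ∀ t : ℝ, 0 < t → (t : EReal) < T → t ≤ n * σ →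
      y t ≤ max (y 0 + B) (B / (A * σ) + 2 * B) := by
    intro n
    induction n with
    | zero => intro t ht _ h0; simp at h0; linarith
    | succ n ih =>
      intro t ht htT htn
      push_cast at htn
      rcases le_or_gt t σ with hts | hts
      · exact (base t ht hts).trans (le_max_left _ _)
      have hpos : 0 < t - σ := by linarith
      have hw := hwin (t - σ) hpos (by rw [← EReal.coe_add]; simpa using htT)
      rw [sub_add_cancel] at hw
      by_cases hex : ∃ r ∈ Ioc (t - σ) t, y r < B / (A * σ)
      · obtain ⟨r, hr, hyr⟩ := hex
        have hr0 : 0 < r := hpos.trans hr.1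
        have h1 := key 0 r t hr0.le hr.2 htT (fun u hu => hy_nonneg u (hr0.trans hu.1).le
          (lt_of_le_of_lt (EReal.coe_le_coe_iff.2 hu.2) htT))
        have h2 := mono (t - σ) r t hpos.le hr.1.le hr.2 htT t hr.2 le_rfl
        refine le_trans ?_ (le_max_right _ _)
        linarith
      · push Not at hex
        have h1 := key _ (t - σ) t hpos.le (by linarith) htT hex
        have h2 : A * (B / (A * σ)) * (t - (t - σ)) = B := by field_simp; ring
        have h3 := ih (t - σ) hpos
          (lt_of_le_of_lt (EReal.coe_le_coe_iff.2 (by linarith)) htT) (by linarith)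
        linarith
  intro t ht htT
  obtain ⟨n, hn⟩ := exists_nat_ge (t / σ)
  exact ind n t ht htT ((div_le_iff₀ hσ).1 hn)
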